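/- arXiv:1905.08020 — 3 statements merged into one kernel-verified Lean document; each statement's English description precedes it below -/
import Mathlib

section
/- Let $d \geq 1$ be an integer and let $h \colon \mathbb{N} \to \mathbb{N}$ be a function such that $h(n) < \tfrac{1}{2d}\log_{16} n$ for all sufficiently large $n$. Let $\alpha \in \mathfrak{S}$, and suppose there exists $n_0$ such that for every $n \geq n_0$ there exists $\beta_n \in \mathfrak{S}$ with $\alpha\,\beta_n \equiv E(u)^{d\,h(n^2)} \pmod{p^n\mathfrak{S}}$. Then there exist an integer $s \geq 0$ and an element $\gamma \in \mathfrak{S}$ such that $\alpha\,\gamma = E(u)^s$. -/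
/-- If the reduction of `α` is nonzero, then `A⟦X⟧ / (α)` is a finite `A`-module. -/
theorem PowerSeries.finite_quotient_span_singleton {A : Type*} [CommRing A] [IsLocalRing A]
    [IsAdicComplete (IsLocalRing.maximalIdeal A) A] (α : PowerSeries A)
    (hα : α.map (IsLocalRing.residue A) ≠ 0) :
    Module.Finite A (PowerSeries A ⧸ Ideal.span {α}) := by
  set l := (α.map (IsLocalRing.residue A)).order.toNat
  let φ : Polynomial A →ₗ[A] PowerSeries A ⧸ Ideal.span {α} :=
    (Ideal.Quotient.mkₐ A (Ideal.span {α})).toLinearMap ∘ₗ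
      (Polynomial.coeToPowerSeries.algHom A).toLinearMap
  have hfin : Module.Finite A (Polynomial.degreeLT A l) :=
    Module.Finite.equiv (Polynomial.degreeLTEquiv A l).symm
  refine Module.Finite.of_surjective (φ ∘ₗ (Polynomial.degreeLT A l).subtype) fun x ↦ ?_
  obtain ⟨f, rfl⟩ := Ideal.Quotient.mk_surjective x
  obtain ⟨q, r, hqr⟩ := PowerSeries.exists_isWeierstrassDivision f hα
  refine ⟨⟨r, Polynomial.mem_degreeLT.2 hqr.degree_lt⟩, ?_⟩
  have h1 : φ r = Ideal.Quotient.mk (Ideal.span {α}) (r : PowerSeries A) := by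
    simp [φ]
  change φ r = _
  rw [h1, Eq.comm, Ideal.Quotient.mk_eq_mk_iff_sub_mem, Ideal.mem_span_singleton]
  exact ⟨q, by rw [hqr.eq_mul_add]; ring⟩

/-- If `p` is a nonzero nonunit of a domain and `x` divides a power of `p`, then `p ^ n` divides
`x ^ m` only if `n` is at most a constant multiple of `m`. -/
theorem le_mul_of_pow_dvd_pow {R : Type*} [CommRing R] [IsDomain R] {p x : R} (hp0 : p ≠ 0)
    (hp : ¬ IsUnit p) {a m n : ℕ} (hx : x ∣ p ^ a) (h : p ^ n ∣ x ^ m) : n ≤ a * m := by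
  have h1 : p ^ n ∣ p ^ (a * m) := h.trans (by rw [pow_mul]; exact pow_dvd_pow_of_dvd hx m)
  exact (pow_dvd_pow_iff hp0 hp).1 h1

theorem exists_mul_lt_of_lt_logb (d : ℕ) (hd : 1 ≤ d) (h : ℕ → ℕ)
    (hh : ∃ N, ∀ n ≥ N, (h n : ℝ) < (1 / (2 * (d : ℝ))) * Real.logb 16 n) (a n₀ : ℕ) :
    ∃ n ≥ n₀, a * (d * h (n ^ 2)) < n := by
  obtain ⟨N, hN⟩ := hh
  have hlim : ∀ᶠ n : ℕ in Filter.atTop, (a : ℝ) * Real.log n ≤ 1 / 2 * n := by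
    have := (Real.isLittleO_log_id_atTop.comp_tendsto
      (tendsto_natCast_atTop_atTop (R := ℝ))).const_mul_left (a : ℝ)
    filter_upwards [this.def (c := 1 / 2) (by norm_num)] with n hn
    simp only [Function.comp, id, Real.norm_eq_abs, Nat.abs_cast] at hn
    exact (le_abs_self _).trans hn
  obtain ⟨n, h1, h2, h3, h4⟩ := (hlim.and ((Filter.eventually_ge_atTop n₀).and
    ((Filter.eventually_ge_atTop N).and (Filter.eventually_ge_atTop 1)))).exists
  refine ⟨n, h2, ?_⟩
  have hb := hN (n ^ 2) (h3.trans (Nat.le_self_pow two_ne_zero n))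
  have hd' : (0 : ℝ) < d := by exact_mod_cast hd
  have hn' : (1 : ℝ) ≤ n := by exact_mod_cast h4
  have hlog : 0 ≤ Real.log n := Real.log_nonneg hn'
  have h16 : (1 : ℝ) ≤ Real.log 16 := by
    rw [Real.le_log_iff_exp_le (by norm_num)]
    linarith [Real.exp_one_lt_d9]
  have hle : (d : ℝ) * h (n ^ 2) ≤ Real.log n := by
    have e1 : (d : ℝ) * ((1 / (2 * (d : ℝ))) * Real.logb 16 ((n ^ 2 : ℕ) : ℝ))
        = Real.log n / Real.log 16 := by
      rw [Real.logb]
      push_cast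
      rw [Real.log_pow]
      field_simp
      push_cast
      ring
    calc (d : ℝ) * h (n ^ 2) ≤ Real.log n / Real.log 16 := by
          rw [← e1]; gcongr
      _ ≤ Real.log n := div_le_self hlog h16
  have : (a : ℝ) * (d * h (n ^ 2)) < n := by
    have := mul_le_mul_of_nonneg_left hle (Nat.cast_nonneg (α := ℝ) a)
    linarith
  exact_mod_cast this


/-- Let `𝔖 = W(k)⟦u⟧` with `k` a perfect field of characteristic `p`, and let
`E` be a monic Eisenstein polynomial of degree `e ≥ 1` over `W(k)`. Let `d ≥ 1` and let
`h : ℕ → ℕ` satisfy `h n < (1/(2d)) log₁₆ n` for all sufficiently large `n`. If `α ∈ 𝔖` is such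
that for some `n₀` and every `n ≥ n₀` there is `βₙ ∈ 𝔖` with
`α βₙ ≡ E(u)^(d h(n²)) (mod pⁿ 𝔖)`, then there are `s ≥ 0` and `γ ∈ 𝔖` with `α γ = E(u)^s`. -/
theorem stmt0 {p : ℕ} [Fact p.Prime] {k : Type*} [Field k] [CharP k p] [PerfectRing k p]
    (e : ℕ) (he : 1 ≤ e) (E : Polynomial (WittVector p k))
    (hmon : E.Monic) (hdeg : E.natDegree = e)
    (heis : ∀ i < e, (p : WittVector p k) ∣ E.coeff i)
    (hcon : ¬ ((p : WittVector p k) ^ 2 ∣ E.coeff 0))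
    (d : ℕ) (hd : 1 ≤ d) (h : ℕ → ℕ)
    (hh : ∃ N, ∀ n ≥ N, (h n : ℝ) < (1 / (2 * (d : ℝ))) * Real.logb 16 n)
    (α : PowerSeries (WittVector p k))
    (hα : ∃ n₀, ∀ n ≥ n₀, ∃ β : PowerSeries (WittVector p k),
      (p : PowerSeries (WittVector p k)) ^ n ∣
        α * β - (E : PowerSeries (WittVector p k)) ^ (d * h (n ^ 2))) :
    ∃ (s : ℕ) (γ : PowerSeries (WittVector p k)),
      α * γ = (E : PowerSeries (WittVector p k)) ^ s := by
  obtain ⟨n₀, hα⟩ := hα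
  have hmax : IsLocalRing.maximalIdeal (WittVector p k) = Ideal.span {(p : WittVector p k)} :=
    (WittVector.irreducible p).maximalIdeal_eq
  have : IsAdicComplete (IsLocalRing.maximalIdeal (WittVector p k)) (WittVector p k) := by
    rw [hmax]; infer_instance
  have hpmem : (p : WittVector p k) ∈ IsLocalRing.maximalIdeal (WittVector p k) := by
    rw [hmax]; exact Ideal.mem_span_singleton_self _
  have hα0 : α.map (IsLocalRing.residue (WittVector p k)) ≠ 0 := by
    intro h0
    obtain ⟨β, hβ⟩ := hα (n₀ + 1) (by omega)
    have hp0 : IsLocalRing.residue (WittVector p k) p = 0 :=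
      (IsLocalRing.residue_eq_zero_iff _).2 hpmem
    have h1 := map_dvd (PowerSeries.map (IsLocalRing.residue (WittVector p k)))
      ((dvd_pow_self _ n₀.succ_ne_zero).trans hβ)
    have hp1 : PowerSeries.map (IsLocalRing.residue (WittVector p k))
        (p : PowerSeries (WittVector p k)) = 0 := by
      rw [map_natCast, ← map_natCast (PowerSeries.C (R := IsLocalRing.ResidueField (WittVector p k))),
        ← map_natCast (IsLocalRing.residue (WittVector p k)), hp0, map_zero]
    rw [hp1, zero_dvd_iff, map_sub, map_mul, h0, zero_mul, zero_sub, neg_eq_zero, map_pow] at h1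
    have h2 := congrArg (PowerSeries.coeff e) (eq_zero_of_pow_eq_zero h1)
    rw [PowerSeries.coeff_map, Polynomial.coeff_coe, ← hdeg, hmon.coeff_natDegree, map_one,
      map_zero] at h2
    exact one_ne_zero h2
  suffices hrad : (E : PowerSeries (WittVector p k)) ∈ (Ideal.span {α}).radical by
    obtain ⟨s, hs⟩ := hrad
    obtain ⟨γ, hγ⟩ := Ideal.mem_span_singleton.1 hs
    exact ⟨s, γ, hγ.symm⟩
  rw [Ideal.radical_eq_sInf, Ideal.mem_sInf]
  rintro Q ⟨hQα, hQ⟩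
  by_contra hEQ
  have hαQ : α ∈ Q := hQα (Ideal.mem_span_singleton_self α)
  let π := Ideal.Quotient.mk Q
  have hdvd : ∀ n ≥ n₀, (p : PowerSeries (WittVector p k) ⧸ Q) ^ n ∣ π E ^ (d * h (n ^ 2)) := by
    intro n hn
    obtain ⟨β, hβ⟩ := hα n hn
    have h1 := map_dvd π hβ
    rw [map_sub, map_mul, Ideal.Quotient.eq_zero_iff_mem.2 hαQ, zero_mul, zero_sub, dvd_neg,
      map_pow, map_pow, map_natCast] at h1
    exact h1
  have hE0 : π E ≠ 0 := fun h0 ↦ hEQ (Ideal.Quotient.eq_zero_iff_mem.1 h0)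
  have hp0 : (p : PowerSeries (WittVector p k) ⧸ Q) ≠ 0 := by
    intro h0
    have h1 := hdvd (n₀ + 1) (by omega)
    rw [h0, zero_pow n₀.succ_ne_zero, zero_dvd_iff] at h1
    exact hE0 (eq_zero_of_pow_eq_zero h1)
  have hpu : ¬ IsUnit (p : PowerSeries (WittVector p k) ⧸ Q) := by
    intro hu
    have hloc : IsLocalHom π := .of_surjective π Ideal.Quotient.mk_surjective
    have h1 : IsUnit (p : PowerSeries (WittVector p k)) :=
      isUnit_of_map_unit π _ (by rwa [map_natCast])
    have h2 := h1.map (PowerSeries.constantCoeff (R := WittVector p k))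
    rw [map_natCast] at h2
    exact (WittVector.irreducible p).not_isUnit h2
  have hfin : Module.Finite (WittVector p k) (PowerSeries (WittVector p k) ⧸ Q) := by
    have := PowerSeries.finite_quotient_span_singleton α hα0
    exact Module.Finite.of_surjective (Ideal.Quotient.factorₐ (WittVector p k) hQα).toLinearMap
      (Ideal.Quotient.factor_surjective hQα)
  obtain ⟨w, hw0, hw⟩ := (Algebra.IsIntegral.isIntegral (R := WittVector p k)
    (π E)).isAlgebraic.exists_nonzero_dvd (mem_nonZeroDivisors_of_ne_zero hE0)
  obtain ⟨a, b, rfl⟩ := WittVector.exists_eq_pow_p_mul' w hw0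
  rw [map_mul, map_pow, map_natCast, (b.isUnit.map _).dvd_mul_right] at hw
  obtain ⟨n, hn, hlt⟩ := exists_mul_lt_of_lt_logb d hd h hh a n₀
  exact absurd (le_mul_of_pow_dvd_pow hp0 hpu hw (hdvd n hn)) (by omega)
end

section
/- Let $n \geq 2$ and let $f, g \in \mathfrak{S}$. Suppose $E(u)$ divides $fg$ in $\mathfrak{S}_n$, i.e. there exists $h \in \mathfrak{S}$ with $fg \equiv E(u)h \pmod{p^n\mathfrak{S}}$. Then $E(u)$ divides $f$ in $\mathfrak{S}_{\lfloor n/2 \rfloor}$ or $E(u)$ divides $g$ in $\mathfrak{S}_{\lfloor n/2 \rfloor}$, where $\lfloor \cdot \rfloor$ is the floor function. -/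
/-- A regular element `x` with the prime divisibility property splits its powers along products. -/
theorem pow_dvd_or_pow_dvd_of_pow_add_dvd_mul {R : Type*} [CommRing R] {x : R}
    (hreg : ∀ a b, x * a = x * b → a = b) (hprime : ∀ a b, x ∣ a * b → x ∣ a ∨ x ∣ b)
    (m l : ℕ) (a b : R) (h : x ^ (m + l) ∣ a * b) : x ^ m ∣ a ∨ x ^ l ∣ b := by
  induction hs : m + l generalizing m l a b with
  | zero => left; simp [show m = 0 by omega]
  | succ s ih =>
    rcases m with _ | m
    · left; simp
    rcases l with _ | l
    · right; simp
    obtain ⟨c, hc⟩ := h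
    rcases hprime a b (hc ▸ Dvd.dvd.mul_right (dvd_pow_self x (by omega)) c)
      with ⟨d, rfl⟩ | ⟨d, rfl⟩
    · have hd : x ^ (m + (l + 1)) ∣ d * b := ⟨c, hreg _ _ (by rw [← mul_assoc, hc]; ring)⟩
      rcases ih m (l + 1) d b hd (by omega) with h1 | h1
      · left; rw [pow_succ']; exact mul_dvd_mul_left x h1
      · right; exact h1
    · have hd : x ^ (m + 1 + l) ∣ a * d :=
        ⟨c, hreg _ _ (by rw [mul_left_comm, hc]; ring)⟩
      rcases ih (m + 1) l a d hd (by omega) with h1 | h1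
      · left; exact h1
      · right; rw [pow_succ']; exact mul_dvd_mul_left x h1

theorem PowerSeries.dvd_mk_span_iff {R : Type*} [CommRing R] (E a f : PowerSeries R) :
    Ideal.Quotient.mk (Ideal.span {E}) a ∣ Ideal.Quotient.mk (Ideal.span {E}) f ↔
      ∃ h, a ∣ f - E * h := by
  constructor
  · rintro ⟨c, hc⟩
    obtain ⟨c, rfl⟩ := Ideal.Quotient.mk_surjective c
    rw [← map_mul, Ideal.Quotient.mk_eq_mk_iff_sub_mem, Ideal.mem_span_singleton] at hc
    obtain ⟨h, hh⟩ := hc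
    exact ⟨h, c, by rw [← hh]; ring⟩
  · rintro ⟨h, c, hc⟩
    refine ⟨Ideal.Quotient.mk _ c, ?_⟩
    rw [← map_mul, Ideal.Quotient.mk_eq_mk_iff_sub_mem, Ideal.mem_span_singleton]
    exact ⟨h, by rw [← hc]; ring⟩

/-- If the constant coefficient of `E` is nonzero, then `X` is regular modulo `E`. -/
theorem PowerSeries.mk_X_mul_cancel {R : Type*} [CommRing R] [IsDomain R] {E : PowerSeries R}
    (hE : constantCoeff E ≠ 0) (a b : PowerSeries R ⧸ Ideal.span {E})
    (h : Ideal.Quotient.mk (Ideal.span {E}) X * a = Ideal.Quotient.mk (Ideal.span {E}) X * b) :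
    a = b := by
  obtain ⟨a, rfl⟩ := Ideal.Quotient.mk_surjective a
  obtain ⟨b, rfl⟩ := Ideal.Quotient.mk_surjective b
  rw [← map_mul, ← map_mul, Ideal.Quotient.mk_eq_mk_iff_sub_mem, Ideal.mem_span_singleton] at h
  rw [Ideal.Quotient.mk_eq_mk_iff_sub_mem, Ideal.mem_span_singleton]
  obtain ⟨y, hy⟩ := h
  have h0 := congrArg constantCoeff hy
  simp only [map_sub, map_mul, constantCoeff_X, zero_mul, sub_zero] at h0
  obtain ⟨z, rfl⟩ := X_dvd_iff.mpr ((mul_eq_zero.mp h0.symm).resolve_left hE)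
  exact ⟨z, mul_left_cancel₀ (X_ne_zero (R := R)) (by rw [mul_sub, hy]; ring)⟩

theorem PowerSeries.mk_X_dvd_iff {R : Type*} [CommRing R] (E f : PowerSeries R) :
    Ideal.Quotient.mk (Ideal.span {E}) X ∣ Ideal.Quotient.mk (Ideal.span {E}) f ↔
      constantCoeff E ∣ constantCoeff f := by
  simp only [dvd_mk_span_iff, X_dvd_iff, map_sub, map_mul, sub_eq_zero]
  exact ⟨fun ⟨h, hh⟩ => ⟨_, hh⟩, fun ⟨c, hc⟩ => ⟨C c, by simpa using hc⟩⟩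

/-- If the constant coefficient of `E` is prime, then `X` has the prime divisibility property
modulo `E`. -/
theorem PowerSeries.mk_X_dvd_or_dvd {R : Type*} [CommRing R] {E : PowerSeries R}
    (hE : Prime (constantCoeff E)) (a b : PowerSeries R ⧸ Ideal.span {E})
    (h : Ideal.Quotient.mk (Ideal.span {E}) X ∣ a * b) :
    Ideal.Quotient.mk (Ideal.span {E}) X ∣ a ∨ Ideal.Quotient.mk (Ideal.span {E}) X ∣ b := by
  obtain ⟨a, rfl⟩ := Ideal.Quotient.mk_surjective a
  obtain ⟨b, rfl⟩ := Ideal.Quotient.mk_surjective b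
  rw [← map_mul, mk_X_dvd_iff, map_mul] at h
  rw [mk_X_dvd_iff, mk_X_dvd_iff]
  exact hE.dvd_or_dvd h

theorem WittVector.isUnit_of_not_dvd {p : ℕ} [Fact p.Prime] {k : Type*} [Field k] [CharP k p]
    [PerfectRing k p] {w : WittVector p k} (hw : ¬ (p : WittVector p k) ∣ w) : IsUnit w := by
  refine isUnit_of_coeff_zero_ne_zero w fun h => hw ?_
  rwa [← Ideal.mem_span_singleton, mem_span_p_iff_coeff_zero_eq_zero]

/-- Modulo an Eisenstein polynomial of degree `e`, the prime is associated to `X ^ e`. -/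
theorem Polynomial.associated_mk_X_pow {R : Type*} [CommRing R] {ϖ : R} {E : Polynomial R}
    (hmon : E.Monic) (he : 1 ≤ E.natDegree) (heis : ∀ i < E.natDegree, ϖ ∣ E.coeff i)
    (hunit : ∀ w, E.coeff 0 = ϖ * w → IsUnit w) :
    Associated
      (Ideal.Quotient.mk (Ideal.span {(E : PowerSeries R)}) (PowerSeries.C ϖ))
      (Ideal.Quotient.mk (Ideal.span {(E : PowerSeries R)}) PowerSeries.X ^ E.natDegree) := by
  choose! c hc using heis
  let v : PowerSeries R := PowerSeries.mk fun i => if i < E.natDegree then - c i else 0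
  have hv : IsUnit v := by
    rw [PowerSeries.isUnit_iff_constantCoeff, ← PowerSeries.coeff_zero_eq_constantCoeff_apply,
      PowerSeries.coeff_mk, if_pos (by omega)]
    exact (hunit _ (hc 0 (by omega))).neg
  refine ⟨(hv.map (Ideal.Quotient.mk (Ideal.span {(E : PowerSeries R)}))).unit, ?_⟩
  rw [IsUnit.unit_spec, ← map_mul, ← map_pow, eq_comm, Ideal.Quotient.mk_eq_mk_iff_sub_mem,
    Ideal.mem_span_singleton]
  refine ⟨1, ?_⟩
  ext i
  rw [mul_one, map_sub, PowerSeries.coeff_C_mul, PowerSeries.coeff_X_pow, PowerSeries.coeff_mk,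
    Polynomial.coeff_coe]
  rcases lt_trichotomy i E.natDegree with h | h | h
  · simp [h, h.ne, hc i h]
  · simp [h, hmon.coeff_natDegree]
  · simp [h.ne', h.not_gt, Polynomial.coeff_eq_zero_of_natDegree_lt h]

/-- (Liu, Lem. 4.2.2) Let `𝔖 = W(k)⟦u⟧` and let `E` be a monic Eisenstein
polynomial of degree `e ≥ 1`. Let `n ≥ 2` and `f, g ∈ 𝔖`. If `E(u)` divides `f g` in
`𝔖ₙ = 𝔖/pⁿ𝔖`, then `E(u)` divides `f` in `𝔖_{⌊n/2⌋}` or `E(u)` divides `g` in `𝔖_{⌊n/2⌋}`. -/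
theorem stmt1 {p : ℕ} [Fact p.Prime] {k : Type*} [Field k] [CharP k p] [PerfectRing k p]
    (e : ℕ) (he : 1 ≤ e) (E : Polynomial (WittVector p k))
    (hmon : E.Monic) (hdeg : E.natDegree = e)
    (heis : ∀ i < e, (p : WittVector p k) ∣ E.coeff i)
    (hcon : ¬ ((p : WittVector p k) ^ 2 ∣ E.coeff 0))
    (n : ℕ) (hn : 2 ≤ n) (f g : PowerSeries (WittVector p k))
    (hfg : ∃ h : PowerSeries (WittVector p k),
      (p : PowerSeries (WittVector p k)) ^ n ∣
        f * g - (E : PowerSeries (WittVector p k)) * h) :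
    (∃ h : PowerSeries (WittVector p k),
        (p : PowerSeries (WittVector p k)) ^ (n / 2) ∣
          f - (E : PowerSeries (WittVector p k)) * h) ∨
    (∃ h : PowerSeries (WittVector p k),
        (p : PowerSeries (WittVector p k)) ^ (n / 2) ∣
          g - (E : PowerSeries (WittVector p k)) * h) := by
  subst hdeg
  have hE0 : PowerSeries.constantCoeff (E : PowerSeries (WittVector p k)) = E.coeff 0 := by
    rw [← PowerSeries.coeff_zero_eq_constantCoeff_apply, Polynomial.coeff_coe]
  have hunit : ∀ w, E.coeff 0 = (p : WittVector p k) * w → IsUnit w := fun w hw =>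
    WittVector.isUnit_of_not_dvd fun hd => hcon (by rw [hw, sq]; exact mul_dvd_mul_left _ hd)
  have hprime : Prime (PowerSeries.constantCoeff (E : PowerSeries (WittVector p k))) := by
    obtain ⟨w, hw⟩ := heis 0 he
    rw [hE0, hw]
    exact (associated_mul_unit_right _ _ (hunit w hw)).prime (WittVector.irreducible p).prime
  have hassoc := Polynomial.associated_mk_X_pow hmon he heis hunit
  rw [map_natCast PowerSeries.C] at hassoc
  simp only [← PowerSeries.dvd_mk_span_iff, map_pow] at hfg ⊢
  rw [(hassoc.pow_pow).dvd_iff_dvd_left, ← pow_mul] at hfg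
  rw [(hassoc.pow_pow).dvd_iff_dvd_left, (hassoc.pow_pow).dvd_iff_dvd_left, ← pow_mul]
  refine pow_dvd_or_pow_dvd_of_pow_add_dvd_mul (PowerSeries.mk_X_mul_cancel hprime.ne_zero)
    (PowerSeries.mk_X_dvd_or_dvd hprime) _ _ _ _ ?_
  rw [← map_mul]
  refine (pow_dvd_pow _ ?_).trans hfg
  rw [← mul_add]
  exact Nat.mul_le_mul_left _ (by omega)
end

section
/- Let $n \geq 1$, let $f, g \in \mathfrak{S}$, and let $k$ be an integer with $0 \leq k < n$. Suppose $E(u)^k$ divides $fg$ in $\mathfrak{S}_{2^n}$. Then there exist integers $a, b \geq 0$ with $a + b = k$ such that $E(u)^a$ divides $f$ in $\mathfrak{S}_{2^{n-k}}$ and $E(u)^b$ divides $g$ in $\mathfrak{S}_{2^{n-k}}$. -/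
open PowerSeries in
/-- A constant divides a power series if it divides every coefficient. -/
theorem PowerSeries.C_dvd_of_forall_dvd_coeff {R : Type*} [CommRing R] {r : R} {f : R⟦X⟧}
    (h : ∀ i, r ∣ coeff i f) : C r ∣ f := by
  choose q hq using h
  refine ⟨mk q, ?_⟩
  ext i
  rw [coeff_C_mul, coeff_mk, hq]

open PowerSeries in
/-- An Eisenstein polynomial over a discrete valuation ring is, as a power series, of the form
`X ^ e + ϖ * c` with `c` a unit. -/
theorem PowerSeries.exists_isUnit_coe_eq_X_pow_add {R : Type*} [CommRing R] [IsDomain R]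
    [IsDiscreteValuationRing R] {ϖ : R} (hϖ : Irreducible ϖ) {E : Polynomial R}
    (hmon : E.Monic) (hE : 1 ≤ E.natDegree) (heis : ∀ i < E.natDegree, ϖ ∣ E.coeff i)
    (hcon : ¬ ϖ ^ 2 ∣ E.coeff 0) :
    ∃ c : R⟦X⟧, IsUnit c ∧ (E : R⟦X⟧) = X ^ E.natDegree + C ϖ * c := by
  have h : C ϖ ∣ (E : R⟦X⟧) - X ^ E.natDegree := by
    refine C_dvd_of_forall_dvd_coeff fun i => ?_
    rw [map_sub, Polynomial.coeff_coe, coeff_X_pow]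
    rcases lt_trichotomy i E.natDegree with hi | hi | hi
    · simpa [hi.ne] using heis i hi
    · simp [hi, hmon.coeff_natDegree]
    · simp [hi.ne', Polynomial.coeff_eq_zero_of_natDegree_lt hi]
  obtain ⟨c, hc⟩ := h
  refine ⟨c, ?_, by rw [← hc]; ring⟩
  rw [PowerSeries.isUnit_iff_constantCoeff]
  by_contra hu
  have hd : ϖ ∣ constantCoeff c := by
    rw [← Ideal.mem_span_singleton, ← hϖ.maximalIdeal_eq]
    exact hu
  apply hcon
  have h0 := congrArg (coeff 0) hc
  rw [map_sub, Polynomial.coeff_coe, coeff_X_pow, if_neg (by omega), sub_zero,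
    coeff_C_mul, coeff_zero_eq_constantCoeff_apply] at h0
  rw [h0, pow_two]
  exact mul_dvd_mul_left _ hd

namespace PowerSeries

variable {R : Type*} [CommRing R] {ϖ : R} {e : ℕ} {E c : R⟦X⟧}

/-- Modulo `E = X ^ e + ϖ * c` with `c` a unit, `ϖ ^ m` and `X ^ (e * m)` are associated. -/
theorem exists_C_pow_dvd_sub_iff (hc : IsUnit c) (hE : E = X ^ e + C ϖ * c) (f : R⟦X⟧) (m : ℕ) :
    (∃ h, C ϖ ^ m ∣ f - E * h) ↔ ∃ h, X ^ (e * m) ∣ f - E * h := by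
  obtain ⟨d, hd⟩ := hc.exists_right_inv
  have key : E ∣ (X ^ e) ^ m - (-(C ϖ * c)) ^ m :=
    dvd_trans ⟨1, by rw [hE]; ring⟩ (sub_dvd_pow_sub_pow (X ^ e : R⟦X⟧) (-(C ϖ * c)) m)
  obtain ⟨r, hr⟩ := key
  have hd' : c ^ m * d ^ m = 1 := by rw [← mul_pow, hd, one_pow]
  have hs : ((-1 : R⟦X⟧) ^ m) * (-1) ^ m = 1 := by rw [← mul_pow]; simp
  rw [neg_eq_neg_one_mul, mul_pow, mul_pow] at hr
  rw [pow_mul]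
  constructor
  · rintro ⟨h, y, hy⟩
    refine ⟨h - (-1) ^ m * d ^ m * r * y, (-1) ^ m * d ^ m * y, ?_⟩
    linear_combination hy - (-1) ^ m * d ^ m * y * hr - C ϖ ^ m * y * hd'
      - C ϖ ^ m * y * c ^ m * d ^ m * hs
  · rintro ⟨h, y, hy⟩
    refine ⟨h + r * y, (-1) ^ m * c ^ m * y, ?_⟩
    linear_combination hy + y * hr

variable [IsDomain R]

/-- Powers of `ϖ` are coprime to `X ^ e + ϖ * c`. -/
theorem C_pow_dvd_of_dvd_mul (hϖ : ϖ ≠ 0) (hE : E = X ^ e + C ϖ * c) (m : ℕ) {x : R⟦X⟧}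
    (h : C ϖ ^ m ∣ E * x) : C ϖ ^ m ∣ x := by
  induction m generalizing x with
  | zero => simp
  | succ m ih =>
    have h1 : C ϖ ∣ x := by
      have h2 : C ϖ ∣ X ^ e * x := by
        have h3 : X ^ e * x = E * x - C ϖ * (c * x) := by rw [hE]; ring
        rw [h3]
        exact dvd_sub ((dvd_pow_self _ m.succ_ne_zero).trans h) (dvd_mul_right _ _)
      refine C_dvd_of_forall_dvd_coeff fun i => ?_
      obtain ⟨y, hy⟩ := h2
      have := congrArg (coeff (i + e)) hy
      rw [coeff_X_pow_mul, coeff_C_mul] at this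
      exact ⟨_, this⟩
    obtain ⟨y, rfl⟩ := h1
    have h0 : (C ϖ : R⟦X⟧) ≠ 0 := fun h0 => hϖ (C_injective (by rw [h0, map_zero]))
    rw [pow_succ'] at h ⊢
    rw [mul_left_comm] at h
    exact mul_dvd_mul_left _ (ih ((mul_dvd_mul_iff_left h0).1 h))

theorem not_dvd_X_pow (hϖ : Irreducible ϖ) (he : e ≠ 0) (hc : IsUnit c)
    (hE : E = X ^ e + C ϖ * c) (s : ℕ) : ¬ E ∣ X ^ s := by
  have h0 : constantCoeff E = ϖ * constantCoeff c := by simp [hE, he]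
  have hcu : IsUnit (constantCoeff c) := isUnit_iff_constantCoeff.1 hc
  have hX : ¬ X ∣ E := by
    rw [X_dvd_iff, h0]
    exact mul_ne_zero hϖ.ne_zero hcu.ne_zero
  rintro ⟨d, hd⟩
  obtain ⟨d', rfl⟩ : X ^ s ∣ d :=
    X_prime.pow_dvd_of_dvd_mul_left s hX ⟨1, by rw [mul_one, hd]⟩
  have hXs : (X ^ s : R⟦X⟧) ≠ 0 := pow_ne_zero _ X_ne_zero
  have h1 : E * d' = 1 := mul_left_cancel₀ hXs (by linear_combination -hd)
  have hu : IsUnit (constantCoeff E) :=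
    isUnit_iff_constantCoeff.1 (IsUnit.of_mul_eq_one _ h1)
  rw [h0] at hu
  exact hϖ.not_isUnit (isUnit_of_mul_isUnit_left hu)

variable [IsDiscreteValuationRing R]

/-- Modulo `E = X ^ e + ϖ * c` with `c` a unit, a power series is either divisible by `X ^ N` or
associated to a smaller power of `X`. -/
theorem X_pow_dvd_or_exists_isUnit (hϖ : Irreducible ϖ) (he : e ≠ 0) (hc : IsUnit c)
    (hE : E = X ^ e + C ϖ * c) (f : R⟦X⟧) (N : ℕ) :
    (∃ h, X ^ N ∣ f - E * h) ∨ ∃ i < N, ∃ v h, IsUnit v ∧ f = X ^ i * v + E * h := by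
  induction N with
  | zero => simp
  | succ N ih =>
    rcases ih with ⟨h, q, hq⟩ | ⟨i, hi, v, h, hv, hf⟩
    · by_cases hu : IsUnit q
      · exact .inr ⟨N, N.lt_succ_self, q, h, hu, by linear_combination hq⟩
      left
      obtain ⟨w, hw⟩ : ϖ ∣ constantCoeff q := by
        rw [← Ideal.mem_span_singleton, ← hϖ.maximalIdeal_eq]
        rwa [isUnit_iff_constantCoeff] at hu
      obtain ⟨q', hq'⟩ : X ∣ q - C ϖ * C w := by
        rw [X_dvd_iff]
        simp [hw]
      obtain ⟨d, hd⟩ := hc.exists_right_inv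
      obtain ⟨e, rfl⟩ := Nat.exists_eq_succ_of_ne_zero he
      refine ⟨h + X ^ N * d * C w, q' - X ^ e * d * C w, ?_⟩
      rw [Nat.succ_eq_add_one] at hE
      linear_combination hq + X ^ N * hq' - X ^ N * d * C w * hE - X ^ N * C ϖ * C w * hd
    · exact .inr ⟨i, by omega, v, h, hv, hf⟩

theorem exists_X_pow_dvd_sub_of_mul (hϖ : Irreducible ϖ) (he : e ≠ 0) (hc : IsUnit c)
    (hE : E = X ^ e + C ϖ * c) {f g h : R⟦X⟧} {N : ℕ} (hfg : X ^ (2 * N) ∣ f * g - E * h) :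
    (∃ h, X ^ N ∣ f - E * h) ∨ ∃ h, X ^ N ∣ g - E * h := by
  refine (X_pow_dvd_or_exists_isUnit hϖ he hc hE f N).imp_right ?_
  rintro ⟨i, hi, v, a, hv, hf⟩
  refine (X_pow_dvd_or_exists_isUnit hϖ he hc hE g N).resolve_right ?_
  rintro ⟨j, hj, w, b, hw, hg⟩
  obtain ⟨y, hy⟩ := hfg
  obtain ⟨t, ht⟩ : ∃ t, 2 * N = i + j + 1 + t := ⟨2 * N - (i + j + 1), by omega⟩
  rw [ht] at hy
  have hu : IsUnit (v * w - X * (X ^ t * y)) := by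
    rw [isUnit_iff_constantCoeff]
    simpa using isUnit_iff_constantCoeff.1 (hv.mul hw)
  obtain ⟨z, hz⟩ := hu.exists_right_inv
  refine not_dvd_X_pow hϖ he hc hE (i + j)
    ⟨z * (h - X ^ i * v * b - a * X ^ j * w - E * a * b), ?_⟩
  rw [hf, hg] at hy
  linear_combination z * hy - X ^ (i + j) * hz

/-- If `E ^ K` divides `f * g` modulo `ϖ ^ 2 ^ (m + K)`, then the factors `E` can be distributed
among `f` and `g` modulo `ϖ ^ 2 ^ m`. -/
theorem exists_add_eq_and_C_pow_dvd_sub (hϖ : Irreducible ϖ) (he : e ≠ 0) (hc : IsUnit c)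
    (hE : E = X ^ e + C ϖ * c) (m K : ℕ) {f g h : R⟦X⟧}
    (hfg : C ϖ ^ 2 ^ (m + K) ∣ f * g - E ^ K * h) :
    ∃ a b : ℕ, a + b = K ∧ (∃ h, C ϖ ^ 2 ^ m ∣ f - E ^ a * h) ∧
      ∃ h, C ϖ ^ 2 ^ m ∣ g - E ^ b * h := by
  induction K generalizing f g with
  | zero => exact ⟨0, 0, rfl, ⟨f, by simp⟩, ⟨g, by simp⟩⟩
  | succ K ih =>
    have cancel {f g f₁ : R⟦X⟧} (hfg : C ϖ ^ 2 ^ (m + (K + 1)) ∣ f * g - E ^ (K + 1) * h)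
        (hf : C ϖ ^ 2 ^ (m + K) ∣ f - E * f₁) :
        C ϖ ^ 2 ^ (m + K) ∣ f₁ * g - E ^ K * h := by
      refine C_pow_dvd_of_dvd_mul hϖ.ne_zero hE _ ?_
      have hle : 2 ^ (m + K) ≤ 2 ^ (m + (K + 1)) := Nat.pow_le_pow_right two_pos (by omega)
      have h1 := dvd_sub ((pow_dvd_pow _ hle).trans hfg) (hf.mul_right g)
      convert h1 using 1
      ring
    have lift {f f₁ : R⟦X⟧} {a : ℕ} (hf : C ϖ ^ 2 ^ (m + K) ∣ f - E * f₁)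
        (h₁ : ∃ h, C ϖ ^ 2 ^ m ∣ f₁ - E ^ a * h) : ∃ h, C ϖ ^ 2 ^ m ∣ f - E ^ (a + 1) * h := by
      obtain ⟨h, hh⟩ := h₁
      refine ⟨h, ?_⟩
      have hle : 2 ^ m ≤ 2 ^ (m + K) := Nat.pow_le_pow_right two_pos (by omega)
      have h1 := dvd_add ((pow_dvd_pow _ hle).trans hf) (hh.mul_left E)
      convert h1 using 1
      ring
    have hdiv : (∃ h, C ϖ ^ 2 ^ (m + K) ∣ f - E * h) ∨
        ∃ h, C ϖ ^ 2 ^ (m + K) ∣ g - E * h := by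
      have h1 : ∃ h, C ϖ ^ 2 ^ (m + (K + 1)) ∣ f * g - E * h :=
        ⟨E ^ K * h, by rwa [← mul_assoc, ← pow_succ']⟩
      rw [exists_C_pow_dvd_sub_iff hc hE] at h1 ⊢
      rw [exists_C_pow_dvd_sub_iff hc hE]
      obtain ⟨h', hh'⟩ := h1
      refine exists_X_pow_dvd_sub_of_mul hϖ he hc hE (h := h') ?_
      convert hh' using 2
      ring
    rcases hdiv with ⟨f₁, hf⟩ | ⟨g₁, hg⟩
    · obtain ⟨a, b, hab, ha, hb⟩ := ih (cancel hfg hf)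
      exact ⟨a + 1, b, by omega, lift hf ha, hb⟩
    · rw [mul_comm f g] at hfg
      have h1 := cancel hfg hg
      rw [mul_comm] at h1
      obtain ⟨a, b, hab, ha, hb⟩ := ih h1
      exact ⟨a, b + 1, by omega, ha, lift hg hb⟩

end PowerSeries


/-- Let `𝔖 = W(k₀)⟦u⟧` and let `E` be a monic Eisenstein polynomial of degree
`e ≥ 1`. Let `n ≥ 1`, `f, g ∈ 𝔖`, and `0 ≤ K < n`. If `E(u)^K` divides `f g` in `𝔖_{2ⁿ}`,
then there are `a, b ≥ 0` with `a + b = K` such that `E(u)^a` divides `f` in `𝔖_{2^{n-K}}`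
and `E(u)^b` divides `g` in `𝔖_{2^{n-K}}`. -/
theorem stmt2 {p : ℕ} [Fact p.Prime] {k₀ : Type*} [Field k₀] [CharP k₀ p] [PerfectRing k₀ p]
    (e : ℕ) (he : 1 ≤ e) (E : Polynomial (WittVector p k₀))
    (hmon : E.Monic) (hdeg : E.natDegree = e)
    (heis : ∀ i < e, (p : WittVector p k₀) ∣ E.coeff i)
    (hcon : ¬ ((p : WittVector p k₀) ^ 2 ∣ E.coeff 0))
    (n K : ℕ) (hn : 1 ≤ n) (hK : K < n) (f g : PowerSeries (WittVector p k₀))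
    (hfg : ∃ h : PowerSeries (WittVector p k₀),
      (p : PowerSeries (WittVector p k₀)) ^ (2 ^ n) ∣
        f * g - (E : PowerSeries (WittVector p k₀)) ^ K * h) :
    ∃ a b : ℕ, a + b = K ∧
      (∃ h : PowerSeries (WittVector p k₀),
        (p : PowerSeries (WittVector p k₀)) ^ (2 ^ (n - K)) ∣
          f - (E : PowerSeries (WittVector p k₀)) ^ a * h) ∧
      (∃ h : PowerSeries (WittVector p k₀),
        (p : PowerSeries (WittVector p k₀)) ^ (2 ^ (n - K)) ∣
          g - (E : PowerSeries (WittVector p k₀)) ^ b * h) := by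
  have hp : Irreducible (p : WittVector p k₀) := WittVector.irreducible p
  subst hdeg
  obtain ⟨c, hc, hE⟩ := PowerSeries.exists_isUnit_coe_eq_X_pow_add hp hmon he heis hcon
  have hC : (p : PowerSeries (WittVector p k₀)) = PowerSeries.C (p : WittVector p k₀) :=
    (map_natCast _ p).symm
  obtain ⟨h, hh⟩ := hfg
  obtain ⟨m, rfl⟩ : ∃ m, n = m + K := ⟨n - K, by omega⟩
  rw [Nat.add_sub_cancel]
  rw [hC] at hh ⊢
  exact PowerSeries.exists_add_eq_and_C_pow_dvd_sub hp (Nat.one_le_iff_ne_zero.1 he) hc hE m K hh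
end
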